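/- arXiv:2310.20179 — 3 statements merged into one kernel-verified Lean document; each statement's English description precedes it below -/
import Mathlib

section
/- Let s ≥ 2 be an integer, q = 2^s, m ≥ 2 an integer with m ≡ 2 (mod 4), and n = q^m − 1. Then the minimum distance of C_{(q,m;0)} satisfies: d(C_{(q,m;0)}) ≥ (q+2)/2 if m = 2; d(C_{(q,m;0)}) ≥ 2q^2 − 2q + 2 if m = 6; and d(C_{(q,m;0)}) ≥ q^{(m−2)/2} + 2q − 1 if m ≥ 10. -/
open Finset

/-- The `q`-weight of a nonnegative integer: the sum of its base-`q` digits. -/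
def qWeight (q i : ℕ) : ℕ := (Nat.digits q i).sum

/-- The set `T_{(q,m;j)} = {i : 1 ≤ i ≤ q^m − 2, wt_q(i) ≡ j (mod 2)}`. -/
def Tset (q m j : ℕ) : Set ℕ :=
  {i | 1 ≤ i ∧ i ≤ q ^ m - 2 ∧ qWeight q i % 2 = j}

/-- The cyclic code of length `n` over `F` with defining set `T` with respect to `β ∈ E`:
all words `(c_0, …, c_{n-1})` with `∑_j c_j β^{k j} = 0` for every `k ∈ T`. -/
def cyclicCode (F E : Type*) [Field F] [Field E] [Algebra F E]
    (n : ℕ) (β : E) (T : Set ℕ) : Submodule F (Fin n → F) where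
  carrier := {c | ∀ k ∈ T, ∑ j : Fin n, algebraMap F E (c j) * β ^ (k * (j : ℕ)) = 0}
  add_mem' := by
    intro a b ha hb k hk
    simp only [Set.mem_setOf_eq, Pi.add_apply, map_add, add_mul] at *
    rw [Finset.sum_add_distrib, ha k hk, hb k hk, add_zero]
  zero_mem' := by
    intro k hk
    simp
  smul_mem' := by
    intro r c hc k hk
    simp only [Set.mem_setOf_eq, Pi.smul_apply, smul_eq_mul, map_mul, mul_assoc] at *
    rw [← Finset.mul_sum, hc k hk, mul_zero]

/-- The minimum distance of a code: the least Hamming weight of a nonzero codeword. -/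
noncomputable def minDist {F : Type*} [Field F] [DecidableEq F] {n : ℕ}
    (C : Submodule F (Fin n → F)) : ℕ :=
  sInf {w | ∃ c ∈ C, c ≠ 0 ∧ hammingNorm c = w}

theorem qWeight_cons (q d k : ℕ) (hq : 2 ≤ q) (hd : d < q) :
    qWeight q (d + q * k) = d + qWeight q k := by
  unfold qWeight
  rcases Nat.eq_zero_or_pos (d + q * k) with h | h
  · have hd0 : d = 0 := by omega
    have hk : q * k = 0 := by omega
    have hk0 : k = 0 := by
      rcases Nat.mul_eq_zero.mp hk with h | h
      · omega
      · exact h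
    subst hd0 hk0
    simp
  · rw [Nat.digits_def' (by omega) h]
    have h1 : (d + q * k) % q = d := by
      rw [Nat.add_mul_mod_self_left, Nat.mod_eq_of_lt hd]
    have h2 : (d + q * k) / q = k := by
      rw [Nat.add_mul_div_left _ _ (by omega), Nat.div_eq_of_lt hd, zero_add]
    rw [h1, h2, List.sum_cons]

theorem qWeight_small (q d : ℕ) (hq : 2 ≤ q) (hd : d < q) : qWeight q d = d := by
  have h := qWeight_cons q d 0 hq hd
  simpa [qWeight] using h

theorem qWeight_block (q : ℕ) (hq : 2 ≤ q) (l : ℕ) : ∀ u k : ℕ, u < q ^ l →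
    qWeight q (u + q ^ l * k) = qWeight q u + qWeight q k := by
  induction l with
  | zero =>
    intro u k hu
    have : u = 0 := by simpa using hu
    subst this
    simp [qWeight]
  | succ l ih =>
    intro u k hu
    have hmod := Nat.mod_add_div u q
    have hlt : u % q < q := Nat.mod_lt _ (by omega)
    have hdiv : u / q < q ^ l := by
      rw [Nat.div_lt_iff_lt_mul (by omega)]
      rwa [pow_succ] at hu
    have e : u + q ^ (l + 1) * k = u % q + q * (u / q + q ^ l * k) := by
      conv_lhs => rw [← hmod]
      ring
    rw [e, qWeight_cons q _ _ hq hlt, ih _ _ hdiv]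
    conv_rhs => rw [← hmod]
    rw [qWeight_cons q _ _ hq hlt]
    ring

theorem block_lt {q d k K : ℕ} (hd : d < q) (hk : k < K) : d + q * k < q * K := by
  calc d + q * k < q + q * k := by omega
    _ = q * (k + 1) := by ring
    _ ≤ q * K := Nat.mul_le_mul_left _ hk

/-- BCH bound along an arithmetic progression with step coprime to `n`. -/
theorem bch {F E : Type*} [Field F] [DecidableEq F] [Field E] [Algebra F E]
    (n : ℕ) (β : E) (hβ : orderOf β = n) (T : Set ℕ) (hT : ∀ k ∈ T, 1 ≤ k ∧ k < n) (hn : 1 ≤ n)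
    (a b L : ℕ) (hb : Nat.Coprime b n)
    (h : ∀ t < L, ∃ k ∈ T, k ≡ a + b * t [MOD n]) :
    L + 1 ≤ minDist (cyclicCode F E n β T) := by
  classical
  have hβn : β ^ n = 1 := by rw [← hβ]; exact pow_orderOf_eq_one β
  have hfin : IsOfFinOrder β := orderOf_pos_iff.mp (by omega)
  have hβ0 : β ≠ 0 := by
    rintro rfl
    rw [zero_pow (by omega)] at hβn
    exact zero_ne_one hβn
  unfold minDist
  apply le_csInf
  · refine ⟨_, fun _ => 1, ?_, ?_, rfl⟩
    · intro k hk
      obtain ⟨h1, h2⟩ := hT k hk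
      simp only [map_one, one_mul]
      have hne : β ^ k ≠ 1 := pow_ne_one_of_lt_orderOf (by omega) (by omega)
      rw [Fin.sum_univ_eq_sum_range (fun j => β ^ (k * j)) n]
      simp only [pow_mul]
      rw [geom_sum_eq hne, ← pow_mul, mul_comm k n, pow_mul, hβn, one_pow, sub_self, zero_div]
    · intro h0
      have := congrFun h0 ⟨0, by omega⟩
      simp at this
  · rintro w ⟨c, hc, hc0, rfl⟩
    by_contra hlt
    push Not at hlt
    obtain ⟨j0, hj0⟩ := Function.ne_iff.mp hc0
    have key : ∀ t < L, ∑ j : Fin n, algebraMap F E (c j) * β ^ (a * (j : ℕ)) *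
        (β ^ (b * (j : ℕ))) ^ t = 0 := by
      intro t ht
      obtain ⟨k, hk, hmod⟩ := h t ht
      rw [← hc k hk]
      refine Finset.sum_congr rfl fun j _ => ?_
      rw [mul_assoc, ← pow_mul, ← pow_add]
      congr 1
      rw [hfin.pow_eq_pow_iff_modEq, hβ]
      have := (hmod.mul_right (j : ℕ)).symm
      convert this using 1
      ring
    have keyP : ∀ P : Polynomial E, P.natDegree < L →
        ∑ j : Fin n, algebraMap F E (c j) * β ^ (a * (j : ℕ)) * P.eval (β ^ (b * (j : ℕ))) = 0 := by
      intro P hP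
      simp only [Polynomial.eval_eq_sum_range, Finset.mul_sum]
      rw [Finset.sum_comm]
      refine Finset.sum_eq_zero fun t ht => ?_
      have ht' : t < L := by
        have := Finset.mem_range.mp ht
        omega
      have := congrArg (fun x => P.coeff t * x) (key t ht')
      simp only [mul_zero, Finset.mul_sum] at this
      rw [← this]
      refine Finset.sum_congr rfl fun j _ => ?_
      ring
    set S : Finset (Fin n) := Finset.univ.filter fun j => c j ≠ 0 with hS
    have hcard : S.card = hammingNorm c := rfl
    have hj0S : j0 ∈ S := by simp [hS]; simpa using hj0
    let P : Polynomial E := ∏ j ∈ S.erase j0, (Polynomial.X - Polynomial.C (β ^ (b * (j : ℕ))))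
    have hdeg : P.natDegree < L := by
      have : P.natDegree = (S.erase j0).card := by
        simp only [P]
        exact Polynomial.natDegree_finsetProd_X_sub_C_eq_card _ _
      have h2 : 0 < S.card := Finset.card_pos.mpr ⟨j0, hj0S⟩
      rw [this, Finset.card_erase_of_mem hj0S]
      omega
    have hsum := keyP P hdeg
    rw [Finset.sum_eq_single j0] at hsum
    · have h1 : algebraMap F E (c j0) ≠ 0 := by
        simpa using hj0
      have h2 : β ^ (a * (j0 : ℕ)) ≠ 0 := pow_ne_zero _ hβ0
      have h3 : P.eval (β ^ (b * (j0 : ℕ))) ≠ 0 := by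
        simp only [P, Polynomial.eval_prod]
        refine Finset.prod_ne_zero_iff.mpr fun j hj => ?_
        simp only [Polynomial.eval_sub, Polynomial.eval_X, Polynomial.eval_C]
        rw [sub_ne_zero]
        intro heq
        rw [hfin.pow_eq_pow_iff_modEq, hβ] at heq
        have := Nat.ModEq.cancel_left_of_coprime (by rw [Nat.gcd_comm]; exact hb) heq
        have h4 : (j0 : ℕ) = j := by
          have h5 := this
          unfold Nat.ModEq at h5
          rwa [Nat.mod_eq_of_lt j0.2, Nat.mod_eq_of_lt j.2] at h5
        exact (Finset.mem_erase.mp hj).1 (Fin.ext h4.symm)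
      exact mul_ne_zero (mul_ne_zero h1 h2) h3 hsum
    · intro j _ hj
      by_cases hcj : c j = 0
      · simp [hcj]
      · have : P.eval (β ^ (b * (j : ℕ))) = 0 := by
          simp only [P, Polynomial.eval_prod]
          refine Finset.prod_eq_zero (i := j) ?_ ?_
          · simp [hS, hj, hcj]
          · simp
        rw [this, mul_zero]
    · intro h; exact absurd (Finset.mem_univ _) h

theorem mem_T (q m k n : ℕ) (hn : n = q ^ m - 1) (h : 4 ≤ q ^ m) (hk : k ∈ Tset q m 0) :
    1 ≤ k ∧ k < n := by
  obtain ⟨h1, h2, _⟩ := hk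
  omega

theorem coprime_big (s q l : ℕ) (hs : 2 ≤ s) (hq : q = 2 ^ s) (hl : l % 2 = 0) :
    Nat.Coprime (1 + q ^ l) (q ^ (2 * l + 2) - 1) := by
  refine Nat.Coprime.symm ?_
  rw [Nat.coprime_iff_gcd_eq_one]
  by_contra hne
  obtain ⟨p, hp, hpd⟩ := Nat.exists_prime_and_dvd hne
  have := Fact.mk hp
  have h1 := hpd.trans (Nat.gcd_dvd_left _ _)
  have h2 := hpd.trans (Nat.gcd_dvd_right _ _)
  have hq1 : 1 ≤ q ^ (2 * l + 2) := Nat.one_le_pow _ _ (by rw [hq]; positivity)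
  have e1 : (q : ZMod p) ^ (2 * l + 2) = 1 := by
    have := (ZMod.natCast_eq_zero_iff _ p).mpr h1
    rw [Nat.cast_sub hq1] at this
    push_cast at this
    exact sub_eq_zero.mp this
  have e2 : 1 + (q : ZMod p) ^ l = 0 := by
    have := (ZMod.natCast_eq_zero_iff _ p).mpr h2
    exact_mod_cast this
  obtain ⟨r, hr⟩ : ∃ r, l = 2 * r := ⟨l / 2, by omega⟩
  have e3 : (q : ZMod p) ^ l = -1 := by linear_combination e2
  have e4 : (q : ZMod p) ^ 2 = 1 := by
    have : (q : ZMod p) ^ (2 * l + 2) = ((q : ZMod p) ^ l) ^ 2 * (q : ZMod p) ^ 2 := by ring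
    rw [this, e3] at e1
    linear_combination e1
  rw [hr, pow_mul, e4, one_pow] at e3
  have e5 : (2 : ZMod p) = 0 := by linear_combination e3
  have e6 : (q : ZMod p) = 0 := by
    rw [hq]; push_cast; rw [e5, zero_pow (by omega)]
  rw [e6] at e4
  simp at e4

theorem coprime_six (s q : ℕ) (hs : 2 ≤ s) (hq : q = 2 ^ s) :
    Nat.Coprime (1 + q + q ^ 2 + q ^ 4) (q ^ 6 - 1) := by
  refine Nat.Coprime.symm ?_
  rw [Nat.coprime_iff_gcd_eq_one]
  by_contra hne
  obtain ⟨p, hp, hpd⟩ := Nat.exists_prime_and_dvd hne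
  have := Fact.mk hp
  have h1 := hpd.trans (Nat.gcd_dvd_left _ _)
  have h2 := hpd.trans (Nat.gcd_dvd_right _ _)
  have hq1 : 1 ≤ q ^ 6 := Nat.one_le_pow _ _ (by rw [hq]; positivity)
  have e1 : (q : ZMod p) ^ 6 = 1 := by
    have := (ZMod.natCast_eq_zero_iff _ p).mpr h1
    rw [Nat.cast_sub hq1] at this
    push_cast at this
    exact sub_eq_zero.mp this
  have e2 : 1 + (q : ZMod p) + (q : ZMod p) ^ 2 + (q : ZMod p) ^ 4 = 0 := by
    have := (ZMod.natCast_eq_zero_iff _ p).mpr h2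
    exact_mod_cast this
  have hq0 : (q : ZMod p) ≠ 0 := by
    intro h
    rw [h] at e1
    simp at e1
  have h20 : (2 : ZMod p) ≠ 0 := by
    intro h
    apply hq0
    rw [hq]; push_cast; rw [h, zero_pow (by omega)]
  generalize (q : ZMod p) = x at *
  have hf : (x - 1) * ((x + 1) * ((x ^ 2 + x + 1) * (x ^ 2 - x + 1))) = 0 := by
    linear_combination e1
  rcases mul_eq_zero.mp hf with h | h
  · have hx : x = 1 := sub_eq_zero.mp h
    subst hx
    apply mul_ne_zero h20 h20
    linear_combination e2
  rcases mul_eq_zero.mp h with h | h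
  · have hx : x = -1 := by linear_combination h
    subst hx
    apply h20
    linear_combination e2
  rcases mul_eq_zero.mp h with h | h
  · apply pow_ne_zero 4 hq0
    linear_combination e2 - h
  · apply hq0
    linear_combination e2 - (x ^ 2 + x + 1) * h

/-- Membership in `T` from six explicit digits. -/
theorem six_mem (q d0 d1 d2 d3 d4 d5 : ℕ) (hq : 4 ≤ q) (h0 : d0 < q) (h1 : d1 < q) (h2 : d2 < q)
    (h3 : d3 < q) (h4 : d4 < q) (h5 : d5 < q)
    (hpos : 1 ≤ d0 + d1 + d2 + d3 + d4 + d5)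
    (hlt : d0 + 1 < q ∨ d1 + 1 < q ∨ d2 + 1 < q ∨ d3 + 1 < q)
    (hev : (d0 + d1 + d2 + d3 + d4 + d5) % 2 = 0) :
    d0 + q * (d1 + q * (d2 + q * (d3 + q * (d4 + q * d5)))) ∈ Tset q 6 0 := by
  have hw : qWeight q (d0 + q * (d1 + q * (d2 + q * (d3 + q * (d4 + q * d5))))) =
      d0 + d1 + d2 + d3 + d4 + d5 := by
    rw [qWeight_cons q _ _ (by omega) h0, qWeight_cons q _ _ (by omega) h1,
      qWeight_cons q _ _ (by omega) h2, qWeight_cons q _ _ (by omega) h3,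
      qWeight_cons q _ _ (by omega) h4, qWeight_small q _ (by omega) h5]
    ring
  have b4 := block_lt h4 h5
  have b3 := block_lt h3 b4
  have b2 := block_lt h2 b3
  have b1 := block_lt h1 b2
  have e6 : q ^ 6 = q * (q * (q * (q * (q * q)))) := by ring
  have hup : d0 + q * (d1 + q * (d2 + q * (d3 + q * (d4 + q * d5)))) + 1 < q ^ 6 := by
    rw [e6]
    have step : ∀ d k K : ℕ, d < q → k + 1 < K → d + q * k + 1 < q * K := by
      intro d k K hd hk
      have : q * (k + 2) ≤ q * K := Nat.mul_le_mul_left _ hk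
      have e : q * (k + 2) = q * k + 2 * q := by ring
      omega
    have step' : ∀ d k K : ℕ, d + 1 < q → k < K → d + q * k + 1 < q * K := by
      intro d k K hd hk
      have := block_lt hd hk
      omega
    rcases hlt with h | h | h | h
    · exact step' _ _ _ h b1
    · exact step _ _ _ h0 (step' _ _ _ h b2)
    · exact step _ _ _ h0 (step _ _ _ h1 (step' _ _ _ h b3))
    · exact step _ _ _ h0 (step _ _ _ h1 (step _ _ _ h2 (step' _ _ _ h b4)))
  refine ⟨?_, by omega, by rw [hw]; exact hev⟩
  by_contra hz
  have hz0 : d0 + q * (d1 + q * (d2 + q * (d3 + q * (d4 + q * d5)))) = 0 := by omega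
  rw [hz0] at hw
  simp [qWeight] at hw
  omega

theorem modEq_wrap (q k v z : ℕ) (hq : 1 ≤ q) (h : k + z * (q ^ 6) = v + z) :
    k ≡ v [MOD (q ^ 6 - 1)] := by
  have hq1 : 1 ≤ q ^ 6 := Nat.one_le_pow _ _ hq
  obtain ⟨N, hN⟩ : ∃ N, q ^ 6 = N + 1 := ⟨q ^ 6 - 1, by omega⟩
  rw [hN] at h ⊢
  have : v = k + N * z := by
    have : k + z * (N + 1) = k + N * z + z := by ring
    omega
  rw [this, Nat.add_sub_cancel]
  unfold Nat.ModEq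
  rw [Nat.add_mul_mod_self_left]

theorem six_ap (s q : ℕ) (hs : 2 ≤ s) (hq : q = 2 ^ s) (t : ℕ) (ht : t < 2 * q ^ 2 - 2 * q + 1) :
    ∃ k ∈ Tset q 6 0, k ≡ (q + q ^ 5) + (1 + q + q ^ 2 + q ^ 4) * t [MOD (q ^ 6 - 1)] := by
  have hq4 : 4 ≤ q := by
    rw [hq]; calc 4 = 2 ^ 2 := by norm_num
      _ ≤ 2 ^ s := Nat.pow_le_pow_right (by norm_num) hs
  have hqe : q % 2 = 0 := by
    rw [hq]
    obtain ⟨r, rfl⟩ : ∃ r, s = r + 1 := ⟨s - 1, by omega⟩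
    rw [pow_succ]; omega
  obtain ⟨x, y, z, hx, hy, hz, rfl⟩ : ∃ x y z, x < q ∧ y < q ∧
      (z = 0 ∨ (z = 1 ∧ (y + 2 < q ∨ (y + 2 = q ∧ x = 0)))) ∧ t = x + q * y + q ^ 2 * z := by
    have e2 : q ^ 2 = q * q := by ring
    have hm1 := Nat.mod_add_div t q
    have hl1 : t % q < q := Nat.mod_lt _ (by omega)
    have hm2 := Nat.mod_add_div (t / q) q
    have hl2 : t / q % q < q := Nat.mod_lt _ (by omega)
    have ht' : t = t % q + q * (t / q % q) + q ^ 2 * (t / q / q) := by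
      conv_lhs => rw [← hm1, ← hm2]
      ring
    refine ⟨t % q, t / q % q, t / q / q, hl1, hl2, ?_, ht'⟩
    generalize t % q = x at *
    generalize t / q % q = y at *
    generalize t / q / q = z at *
    obtain ⟨r, hr⟩ : ∃ r, q = r + 2 := ⟨q - 2, by omega⟩
    have hb : t ≤ q ^ 2 + q * r := by
      have : 2 * q ^ 2 - 2 * q = q ^ 2 + q * r := by
        rw [hr]
        have : 2 * (r + 2) ^ 2 = (r + 2) ^ 2 + (r + 2) * r + 2 * (r + 2) := by ring
        omega
      omega
    rcases Nat.lt_or_ge z 1 with h | h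
    · left; omega
    · right
      have hz1 : z = 1 := by
        by_contra hne
        have : q ^ 2 * 2 ≤ q ^ 2 * z := Nat.mul_le_mul_left _ (by omega)
        have h3 : q ^ 2 = q * r + 2 * q := by rw [hr]; ring
        omega
      subst hz1
      refine ⟨rfl, ?_⟩
      have h5 : x + q * y ≤ q * r := by omega
      rcases Nat.lt_trichotomy y r with h6 | h6 | h6
      · left; omega
      · right; subst h6; omega
      · exfalso
        have : q * (r + 1) ≤ q * y := Nat.mul_le_mul_left _ h6
        have e : q * (r + 1) = q * r + q := by ring
        omega
  clear ht
  rcases hz with rfl | ⟨rfl, hyx⟩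
  · by_cases hA : x + y + 1 < q
    · refine ⟨_, six_mem q x (x + y + 1) (x + y) y x (y + 1) hq4 hx hA (by omega) hy hx (by omega)
        (by omega) (by omega) (by omega), modEq_wrap _ _ _ 0 (by omega) ?_⟩
      ring
    · by_cases hB : y + 1 < q
      · obtain ⟨r, hr⟩ : ∃ r, x + y + 1 = q + r := ⟨x + y + 1 - q, by omega⟩
        refine ⟨_, six_mem q x r r (y + 1) x (y + 1) hq4 hx (by omega) (by omega) hB hx hB
          (by omega) (by omega) (by omega), modEq_wrap _ _ _ 0 (by omega) ?_⟩
        zify at hr ⊢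
        linear_combination (-(q : ℤ) - (q : ℤ) ^ 2) * hr
      · obtain rfl : q = y + 1 := by omega
        by_cases hC : x < y
        · refine ⟨_, six_mem (y + 1) (x + 1) x x 0 (x + 1) 0 hq4 (by omega) hx hx (by omega)
            (by omega) (by omega)
            (by omega) (by omega) (by omega), modEq_wrap _ _ _ 1 (by omega) ?_⟩
          ring
        · obtain rfl : x = y := by omega
          refine ⟨_, six_mem (x + 1) 0 0 0 1 0 1 hq4 (by omega) (by omega) (by omega) (by omega)
            (by omega) (by omega)
            (by omega) (by omega) (by omega), modEq_wrap _ _ _ 1 (by omega) ?_⟩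
          ring
  · by_cases hx1 : x + 1 < q
    · by_cases hA : x + y + 1 < q
      · refine ⟨_, six_mem q (x + 1) (x + y + 1) (x + y + 1) (y + 1) (x + 1) (y + 1) hq4 hx1 hA
          hA (by omega) hx1 (by omega)
          (by omega) ?_ (by omega), modEq_wrap _ _ _ 1 (by omega) ?_⟩
        · omega
        · ring
      · obtain ⟨r, hr⟩ : ∃ r, x + y + 1 = q + r := ⟨x + y + 1 - q, by omega⟩
        refine ⟨_, six_mem q (x + 1) r (r + 1) (y + 2) (x + 1) (y + 1) hq4 hx1 (by omega)
          (by omega) (by omega) hx1 (by omega)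
          (by omega) (by omega) (by omega), modEq_wrap _ _ _ 1 (by omega) ?_⟩
        zify at hr ⊢
        linear_combination (-(q : ℤ) - (q : ℤ) ^ 2) * hr
    · obtain rfl : q = x + 1 := by omega
      refine ⟨_, six_mem (x + 1) 0 (y + 1) (y + 1) (y + 2) 0 (y + 2) hq4 (by omega) (by omega)
        (by omega) (by omega) (by omega) (by omega)
        (by omega) (by omega) (by omega), modEq_wrap _ _ _ 1 (by omega) ?_⟩
      ring

/-- Membership in `T` from two blocks of length `l` and one top digit. -/
theorem big_mem (q l u v e : ℕ) (hq : 4 ≤ q) (hu : u < q ^ l) (hv : v < q ^ l)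
    (he : e < q) (he1 : 1 ≤ e) (hev : (qWeight q u + qWeight q v + e) % 2 = 0) :
    u + q ^ l * (v + q ^ l * e) ∈ Tset q (2 * l + 2) 0 := by
  have hw : qWeight q (u + q ^ l * (v + q ^ l * e)) = qWeight q u + qWeight q v + e := by
    rw [qWeight_block q (by omega) l _ _ hu, qWeight_block q (by omega) l _ _ hv,
      qWeight_small q _ (by omega) he]
    ring
  have hl : 1 ≤ q ^ l := Nat.one_le_pow _ _ (by omega)
  have b := block_lt hu (block_lt hv he)
  have e1 : q ^ (2 * l + 2) = q * (q ^ l * (q ^ l * q)) := by ring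
  have h4 : 4 * (q ^ l * (q ^ l * q)) ≤ q * (q ^ l * (q ^ l * q)) := Nat.mul_le_mul_right _ hq
  have hpos : 1 ≤ q ^ l * (v + q ^ l * e) :=
    Nat.mul_pos hl (by have := Nat.mul_pos hl he1; omega)
  refine ⟨by omega, by omega, by rw [hw]; exact hev⟩

theorem big_ap (s q l : ℕ) (hs : 2 ≤ s) (hq : q = 2 ^ s) (hl : 2 ≤ l) (t : ℕ)
    (ht : t < q ^ l + 2 * q - 2) :
    ∃ k ∈ Tset q (2 * l + 2) 0,
      k = (2 * q ^ (2 * l) - (q - 1) * (1 + q ^ l)) + (1 + q ^ l) * t := by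
  have hq4 : 4 ≤ q := by
    rw [hq]; calc 4 = 2 ^ 2 := by norm_num
      _ ≤ 2 ^ s := Nat.pow_le_pow_right (by norm_num) hs
  have hqe : q % 2 = 0 := by
    rw [hq]
    obtain ⟨r, rfl⟩ : ∃ r, s = r + 1 := ⟨s - 1, by omega⟩
    rw [pow_succ]; omega
  obtain ⟨l', rfl⟩ : ∃ l', l = l' + 1 := ⟨l - 1, by omega⟩
  have hM1 : q ≤ q ^ l' := Nat.le_self_pow (by omega) q
  obtain ⟨M, hM⟩ : ∃ M, q ^ l' = M + 1 := ⟨q ^ l' - 1, by omega⟩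
  have hQ : q ^ (l' + 1) = q * M + q := by rw [pow_succ, hM]; ring
  have hQ2 : q ^ (2 * (l' + 1)) = q ^ (l' + 1) * q ^ (l' + 1) := by ring
  have hQq : q * q ≤ q ^ (l' + 1) := by rw [pow_succ]; exact Nat.mul_le_mul_right _ hM1
  have hQ4 : 4 * q ≤ q * q := Nat.mul_le_mul_right _ hq4
  -- the truncated subtraction is genuine
  have hsub : (q - 1) * (1 + q ^ (l' + 1)) ≤ 2 * q ^ (2 * (l' + 1)) := by
    rw [hQ2]
    calc (q - 1) * (1 + q ^ (l' + 1)) ≤ q ^ (l' + 1) * (2 * q ^ (l' + 1)) :=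
          Nat.mul_le_mul (by omega) (by omega)
      _ = _ := by ring
  obtain ⟨A, hA⟩ := Nat.exists_eq_add_of_le hsub
  rw [hA, Nat.add_sub_cancel_left]
  rw [hQ2] at hA
  obtain ⟨p, hp⟩ : ∃ p, q = p + 1 := ⟨q - 1, by omega⟩
  have hp1 : q - 1 = p := by omega
  rw [hp1] at hA
  rcases Nat.lt_or_ge t p with htp | htp
  · -- negative part, `j = p - t`
    obtain ⟨j, hj⟩ : ∃ j, p = t + j := ⟨p - t, by omega⟩
    have w1 : qWeight q ((q - j) + q * M) = (q - j) + qWeight q M :=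
      qWeight_cons q _ _ (by omega) (by omega)
    have w2 : qWeight q ((q - 1 - j) + q * M) = (q - 1 - j) + qWeight q M :=
      qWeight_cons q _ _ (by omega) (by omega)
    refine ⟨_, big_mem q (l' + 1) ((q - j) + q * M) ((q - 1 - j) + q * M) 1 hq4 (by omega)
      (by omega) (by omega) le_rfl (by rw [w1, w2]; omega), ?_⟩
    have g1 : q - j = t + 1 := by omega
    have g2 : q - 1 - j = t := by omega
    have g3 : q * M = q ^ (l' + 1) - q := by omega
    rw [g1, g2]
    generalize q ^ (l' + 1) = Q at *
    obtain ⟨N, hN⟩ : ∃ N, N = q * M := ⟨_, rfl⟩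
    rw [← hN] at hQ ⊢
    zify at hA hQ hp hj ⊢
    linear_combination hA + (1 + (Q : ℤ)) * (-hQ) + (1 + (Q : ℤ)) * (-hp)
  · obtain ⟨i, rfl⟩ : ∃ i, t = p + i := ⟨t - p, by omega⟩
    rcases Nat.lt_or_ge i (q ^ (l' + 1)) with hi | hi
    · refine ⟨_, big_mem q (l' + 1) i i 2 hq4 hi hi (by omega) (by omega) (by omega), ?_⟩
      generalize q ^ (l' + 1) = Q at *
      zify at hA ⊢
      linear_combination hA
    · obtain ⟨u, rfl⟩ := Nat.exists_eq_add_of_le hi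
      have hu : u + 1 < q := by omega
      refine ⟨_, big_mem q (l' + 1) u (u + 1) 3 hq4 (by omega) (by omega) (by omega) (by omega)
        ?_, ?_⟩
      · rw [qWeight_small q u (by omega) (by omega), qWeight_small q _ (by omega) hu]
        omega
      · generalize q ^ (l' + 1) = Q at *
        zify at hA ⊢
        linear_combination hA

theorem two_ap (q t : ℕ) (hq4 : 4 ≤ q) (hqe : q % 2 = 0) (ht : t < q / 2) :
    (q + 1) + 2 * t ∈ Tset q 2 0 := by
  have e : (q + 1) + 2 * t = (1 + 2 * t) + q * 1 := by ring
  have hw : qWeight q ((q + 1) + 2 * t) = 1 + 2 * t + 1 := by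
    rw [e, qWeight_cons q _ _ (by omega) (by omega), qWeight_small q 1 (by omega) (by omega)]
  have : 4 * q ≤ q ^ 2 := by rw [pow_two]; exact Nat.mul_le_mul_right _ hq4
  exact ⟨by omega, by omega, by rw [hw]; omega⟩

theorem stmt11 (s q m n : ℕ) (hs : 2 ≤ s) (hq : q = 2 ^ s)
    (hm : 2 ≤ m) (hmod4 : m % 4 = 2) (hn : n = q ^ m - 1)
    (F E : Type*) [Field F] [Fintype F] [DecidableEq F] [Field E] [Fintype E] [Algebra F E]
    (hF : Fintype.card F = q) (hE : Fintype.card E = q ^ m)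
    (β : E) (hβ : orderOf β = n) :
    (m = 2 → (q + 2) / 2 ≤ minDist (cyclicCode F E n β (Tset q m 0))) ∧
    (m = 6 → 2 * q ^ 2 - 2 * q + 2 ≤ minDist (cyclicCode F E n β (Tset q m 0))) ∧
    (10 ≤ m → q ^ ((m - 2) / 2) + 2 * q - 1 ≤ minDist (cyclicCode F E n β (Tset q m 0))) := by
  have hq4 : 4 ≤ q := by
    rw [hq]; calc 4 = 2 ^ 2 := by norm_num
      _ ≤ 2 ^ s := Nat.pow_le_pow_right (by norm_num) hs
  have hqe : q % 2 = 0 := by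
    rw [hq]
    obtain ⟨r, rfl⟩ : ∃ r, s = r + 1 := ⟨s - 1, by omega⟩
    rw [pow_succ]; omega
  have hqm : 4 ≤ q ^ m := hq4.trans (Nat.le_self_pow (by omega) q)
  have hT : ∀ k ∈ Tset q m 0, 1 ≤ k ∧ k < n := fun k hk => mem_T q m k n hn hqm hk
  refine ⟨?_, ?_, ?_⟩
  · rintro rfl
    have hcop : Nat.Coprime 2 n := by
      rw [Nat.coprime_two_left, Nat.odd_iff]
      have : q ^ 2 % 2 = 0 := by rw [Nat.pow_mod, hqe]
      omega
    have := bch (F := F) n β hβ (Tset q 2 0) hT (by omega) (q + 1) 2 (q / 2) hcop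
      (fun t ht => ⟨_, two_ap q t hq4 hqe ht, rfl⟩)
    omega
  · rintro rfl
    have := bch (F := F) n β hβ (Tset q 6 0) hT (by omega) (q + q ^ 5) (1 + q + q ^ 2 + q ^ 4)
      (2 * q ^ 2 - 2 * q + 1) (by rw [hn]; exact coprime_six s q hs hq)
      (fun t ht => by rw [hn]; exact six_ap s q hs hq t ht)
    omega
  · intro hm10
    obtain ⟨l, hl⟩ : ∃ l, m = 2 * l + 2 := ⟨(m - 2) / 2, by omega⟩
    subst hl
    have hl2 : (2 * l + 2 - 2) / 2 = l := by omega
    rw [hl2]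
    have := bch (F := F) n β hβ (Tset q (2 * l + 2) 0) hT (by omega)
      (2 * q ^ (2 * l) - (q - 1) * (1 + q ^ l)) (1 + q ^ l)
      (q ^ l + 2 * q - 2) (by rw [hn]; exact coprime_big s q l hs hq (by omega))
      (fun t ht => by
        obtain ⟨k, hk, h⟩ := big_ap s q l hs hq (by omega) t ht
        exact ⟨k, hk, by rw [h]⟩)
    omega
end

section
/- Let s ≥ 2 be an integer, q = 2^s, m ≥ 4 an integer with m ≡ 0 (mod 4), and n = q^m − 1. Then d(C_{(q,m;0)}) ≥ q^{(m−2)/2} + 1 and d(C_{(q,m;1)}) ≥ q^{(m−2)/2} + 1. -/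
open Finset

lemma qw_add_mul (q : ℕ) (hq : 2 ≤ q) (r t : ℕ) (hr : r < q) :
    qWeight q (r + q * t) = r + qWeight q t := by
  unfold qWeight
  by_cases h : r = 0 ∧ t = 0
  · simp [h.1, h.2]
  · rw [Nat.digits_add q (by omega) r t hr (by omega)]
    simp

lemma qw_append (q : ℕ) (hq : 2 ≤ q) (k : ℕ) : ∀ a b, a < q ^ k →
    qWeight q (a + q ^ k * b) = qWeight q a + qWeight q b := by
  induction k with
  | zero =>
    intro a b ha
    have : a = 0 := by simpa using ha
    subst this
    simp [qWeight]
  | succ k ih =>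
    intro a b ha
    have hr : a % q < q := Nat.mod_lt _ (by omega)
    have e : a % q + q * (a / q) = a := Nat.mod_add_div a q
    have ht : a / q < q ^ k := by
      rw [Nat.div_lt_iff_lt_mul (by omega)]
      rwa [← pow_succ]
    have e2 : a + q ^ (k + 1) * b = a % q + q * (a / q + q ^ k * b) := by
      conv_lhs => rw [← e]
      ring
    rw [e2, qw_add_mul q hq _ _ hr, ih _ _ ht]
    conv_rhs => rw [← e, qw_add_mul q hq _ _ hr]
    ring

lemma qw_compl (q : ℕ) (hq : 2 ≤ q) (h : ℕ) : ∀ x y, x + y + 1 = q ^ h →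
    qWeight q x + qWeight q y = h * (q - 1) := by
  induction h with
  | zero =>
    intro x y hx
    have hx0 : x = 0 := by simp at hx; omega
    have hy0 : y = 0 := by simp at hx; omega
    subst hx0; subst hy0
    simp [qWeight]
  | succ k ih =>
    intro x y hxy
    have hr : x % q < q := Nat.mod_lt _ (by omega)
    have e : x % q + q * (x / q) = x := Nat.mod_add_div x q
    have ht : x / q < q ^ k := by
      rw [Nat.div_lt_iff_lt_mul (by omega), ← pow_succ]
      omega
    obtain ⟨z, hz⟩ : ∃ z, x / q + z + 1 = q ^ k := ⟨q ^ k - 1 - x / q, by omega⟩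
    have ey : y = (q - 1 - x % q) + q * z := by
      have h1 : q * (x / q + z + 1) = q ^ (k + 1) := by rw [hz]; ring
      have h2 : q * (x / q + z + 1) = q * (x / q) + q * z + q := by ring
      omega
    rw [ey, qw_add_mul q hq _ _ (by omega)]
    have hxw : qWeight q x = x % q + qWeight q (x / q) := by
      conv_lhs => rw [← e, qw_add_mul q hq _ _ hr]
    rw [hxw]
    have := ih _ _ hz
    have h3 : (k + 1) * (q - 1) = k * (q - 1) + (q - 1) := by ring
    omega

open Classical in
lemma fiber_sum_zero {ι E : Type*} [Field E] (S : Finset ι) (d f : ι → E)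
    (N : ℕ) (hN : S.card ≤ N) (h : ∀ k < N, ∑ j ∈ S, d j * f j ^ k = 0) (j0 : ι)
    (hj0 : j0 ∈ S) :
    ∑ j ∈ S with f j = f j0, d j = 0 := by
  set V : Finset E := (S.image f).erase (f j0) with hV
  set P : Polynomial E := ∏ v ∈ V, (Polynomial.X - Polynomial.C v) with hP
  have hdeg : P.natDegree < N := by
    have h1 : P.natDegree = V.card := by
      rw [hP, Polynomial.natDegree_prod_of_monic _ _ (fun v _ => Polynomial.monic_X_sub_C v)]
      simp
    have h2 : V.card < (S.image f).card :=
      Finset.card_erase_lt_of_mem (Finset.mem_image_of_mem f hj0)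
    have h3 : (S.image f).card ≤ S.card := Finset.card_image_le
    omega
  have hne : P.eval (f j0) ≠ 0 := by
    rw [hP, Polynomial.eval_prod, Finset.prod_ne_zero_iff]
    intro v hv
    simp only [Polynomial.eval_sub, Polynomial.eval_X, Polynomial.eval_C]
    exact sub_ne_zero.2 (Finset.ne_of_mem_erase hv).symm
  have hz : ∀ j ∈ S, f j ≠ f j0 → P.eval (f j) = 0 := by
    intro j hj hn
    rw [hP, Polynomial.eval_prod]
    exact Finset.prod_eq_zero (Finset.mem_erase.2 ⟨hn, Finset.mem_image_of_mem f hj⟩) (by simp)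
  have hsum : ∑ j ∈ S, d j * P.eval (f j) = 0 := by
    simp_rw [Polynomial.eval_eq_sum_range, Finset.mul_sum]
    rw [Finset.sum_comm]
    apply Finset.sum_eq_zero
    intro k hk
    have := h k (by rw [Finset.mem_range] at hk; omega)
    calc ∑ j ∈ S, d j * (P.coeff k * f j ^ k) = P.coeff k * ∑ j ∈ S, d j * f j ^ k := by
          rw [Finset.mul_sum]; exact Finset.sum_congr rfl (fun j _ => by ring)
      _ = 0 := by rw [this, mul_zero]
  have h4 : (∑ j ∈ S with f j = f j0, d j) * P.eval (f j0) = 0 := by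
    rw [← hsum, Finset.sum_filter, Finset.sum_mul]
    apply Finset.sum_congr rfl
    intro j hj
    by_cases hh : f j = f j0
    · simp [hh]
    · simp [hh, hz j hj hh]
  exact (mul_eq_zero.1 h4).resolve_right hne

/-- For every residue `r` modulo `q - 1` there is a shift `A` with `A + (q^h-1) i ∈ T`. -/
lemma exists_shift (q h j r : ℕ) (hq : 4 ≤ q) (hqe : q % 2 = 0) (hh : 1 ≤ h) (hj : j < 2) :
    ∃ A, A ≡ r [MOD (q - 1)] ∧ ∀ i < q ^ h,
      A + (q ^ h - 1) * (i + 1) ∈ Tset q (2 * h + 2) j := by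
  obtain ⟨σ, hσ1, hσ2, hσ3⟩ : ∃ σ, σ ≡ r [MOD (q - 1)] ∧ σ ≤ 2 * q - 3 ∧
      (h * (q - 1) + σ) % 2 = j := by
    have hlt : r % (q - 1) < q - 1 := Nat.mod_lt _ (by omega)
    by_cases hc : (h * (q - 1) + r % (q - 1)) % 2 = j
    · exact ⟨r % (q - 1), Nat.mod_modEq _ _, by omega, hc⟩
    · refine ⟨r % (q - 1) + (q - 1), ?_, by omega, by omega⟩
      unfold Nat.ModEq
      simp
  obtain ⟨u, v, hu, hv, huv⟩ : ∃ u v, u ≤ q - 1 ∧ v ≤ q - 2 ∧ u + v = σ :=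
    ⟨min σ (q - 1), σ - min σ (q - 1), by omega, by omega, by omega⟩
  have hone : ∀ k, q ^ k ≡ 1 [MOD (q - 1)] := by
    intro k
    have : q ≡ 1 [MOD (q - 1)] := by
      have : q = 1 + (q - 1) := by omega
      unfold Nat.ModEq
      conv_lhs => rw [this]
      simp
    simpa using this.pow k
  refine ⟨q ^ (2 * h) * (u + q * v), ?_, ?_⟩
  · have h1 : q ^ (2 * h) * (u + q * v) ≡ 1 * (u + 1 * v) [MOD (q - 1)] := by
      have hq1 := hone 1
      rw [pow_one] at hq1
      exact (hone _).mul ((Nat.ModEq.refl u).add (hq1.mul_right v))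
    rw [one_mul, one_mul, huv] at h1
    exact h1.trans hσ1
  · intro i hi
    obtain ⟨y, hy⟩ : ∃ y, i + y + 1 = q ^ h := ⟨q ^ h - 1 - i, by omega⟩
    have hyl : y < q ^ h := by omega
    have hb : (q ^ h - 1) * (i + 1) = y + q ^ h * i := by
      have hp : q ^ h - 1 = i + y := by omega
      rw [hp, ← hy]; ring
    have hbl : (q ^ h - 1) * (i + 1) < q ^ (2 * h) := by
      rw [hb]
      have h1 : q ^ (2 * h) = q ^ h * q ^ h := by rw [two_mul, pow_add]
      have h2 : q ^ h * (i + 1) ≤ q ^ h * q ^ h := Nat.mul_le_mul_left _ (by omega)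
      have h3 : q ^ h * (i + 1) = q ^ h * i + q ^ h := by ring
      omega
    have hqh : 4 ≤ q ^ h := le_trans hq (Nat.le_self_pow (by omega) q)
    have hw : qWeight q (q ^ (2 * h) * (u + q * v) + (q ^ h - 1) * (i + 1))
        = h * (q - 1) + σ := by
      rw [add_comm, qw_append q (by omega) _ _ _ hbl, hb, qw_append q (by omega) _ _ _ hyl,
        qw_add_mul q (by omega) _ _ (by omega)]
      have hv0 : qWeight q v = v := by
        have := qw_add_mul q (by omega) v 0 (by omega)
        simpa [qWeight] using this
      have := qw_compl q (by omega) h i y hy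
      omega
    refine ⟨?_, ?_, ?_⟩
    · have : 1 ≤ (q ^ h - 1) * (i + 1) := Nat.mul_pos (by omega) (by omega)
      omega
    · have h1 : u + q * v + 1 + q ≤ q * q := by
        have : q * v ≤ q * (q - 2) := Nat.mul_le_mul_left _ hv
        have h2 : q * (q - 2) + 2 * q = q * q := by
          obtain ⟨p, rfl⟩ : ∃ p, q = p + 2 := ⟨q - 2, by omega⟩
          simp only [Nat.add_sub_cancel]
          ring
        omega
      have h2 := Nat.mul_le_mul_left (q ^ (2 * h)) h1
      have h3 : q ^ (2 * h + 2) = q ^ (2 * h) * (q * q) := by ring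
      have h4 : q ^ (2 * h) * (u + q * v + 1 + q)
        = q ^ (2 * h) * (u + q * v) + q ^ (2 * h) + q ^ (2 * h) * q := by ring
      have h5 : 2 ≤ q ^ (2 * h) * q :=
        le_trans (by omega) (Nat.le_mul_of_pos_left q (by positivity))
      omega
    · rw [hw]; exact hσ3

lemma bound_aux (q h m n j : ℕ) (hq : 4 ≤ q) (hqe : q % 2 = 0) (hh : h % 2 = 1)
    (hmh : m = 2 * h + 2) (hj : j < 2) (hn : n = q ^ m - 1)
    (F E : Type*) [Field F] [DecidableEq F] [Field E] [Algebra F E]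
    (β : E) (hβ : orderOf β = n) :
    q ^ h + 1 ≤ minDist (cyclicCode F E n β (Tset q m j)) := by
  classical
  have hqm : 16 ≤ q ^ m := by
    calc 16 ≤ q ^ 2 := by nlinarith
      _ ≤ q ^ m := Nat.pow_le_pow_right (by omega) (by omega)
  have hβn : β ^ n = 1 := hβ ▸ pow_orderOf_eq_one β
  have hβ0 : β ≠ 0 := by
    rintro rfl
    rw [zero_pow (by omega)] at hβn
    exact zero_ne_one hβn
  unfold minDist
  apply le_csInf
  · refine ⟨_, fun _ => 1, ?_, ?_, rfl⟩
    · intro k hk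
      obtain ⟨hk1, hk2, -⟩ := hk
      have hne : β ^ k ≠ 1 := by
        intro he
        have := Nat.le_of_dvd (by omega) (orderOf_dvd_of_pow_eq_one he)
        omega
      simp only [map_one, one_mul, pow_mul]
      rw [Fin.sum_univ_eq_sum_range (fun i => (β ^ k) ^ i) n]
      have hg := geom_sum_mul (β ^ k) n
      rw [← pow_mul, mul_comm k n, pow_mul, hβn, one_pow, sub_self] at hg
      exact (mul_eq_zero.1 hg).resolve_right (sub_ne_zero.2 hne)
    · intro he
      have := congrFun he ⟨0, by omega⟩
      simp at this
  · rintro w ⟨c, hc, hc0, rfl⟩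
    by_contra hlt
    apply hc0
    set S : Finset (Fin n) := Finset.univ.filter (fun i => c i ≠ 0) with hS
    have hcard : S.card ≤ q ^ h := by
      have : hammingNorm c = S.card := rfl
      omega
    have hmemS : ∀ i, c i ≠ 0 → i ∈ S := fun i hi => by simp [hS, hi]
    have hsum : ∀ k ∈ Tset q m j, ∑ i ∈ S, algebraMap F E (c i) * β ^ (k * (i : ℕ)) = 0 := by
      intro k hk
      rw [← hc k hk]
      apply Finset.sum_subset (Finset.subset_univ _)
      intro i _ hi
      have : c i = 0 := by by_contra h'; exact hi (hmemS i h')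
      simp [this]
    funext j0
    by_contra hj0
    have hj0S : j0 ∈ S := hmemS j0 hj0
    set b := q ^ h - 1 with hb
    have hx0 : ∀ i : Fin n, β ^ (i : ℕ) ≠ 0 := fun i => pow_ne_zero _ hβ0
    set f : Fin n → E := fun i => (β ^ (i : ℕ)) ^ b with hf
    set y : Fin n → E := fun i => β ^ (i : ℕ) / β ^ (j0 : ℕ) with hy
    set S' := S.filter (fun i => f i = f j0) with hS'
    have hyq : ∀ i ∈ S', y i ^ (q - 1) = 1 := by
      intro i hi
      have hi2 : f i = f j0 := (Finset.mem_filter.1 hi).2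
      have h1 : y i ^ b = 1 := by
        rw [hy]
        simp only [div_pow]
        exact (div_eq_one_iff_eq (pow_ne_zero _ (hx0 j0))).2 hi2
      have h2 : y i ^ n = 1 := by
        rw [hy]
        simp only [div_pow]
        rw [pow_right_comm, hβn, pow_right_comm β, hβn]
        simp
      have h3 := pow_gcd_eq_one.2 ⟨h1, h2⟩
      have h4 : Nat.gcd b n = q - 1 := by
        rw [hb, hn, Nat.pow_sub_one_gcd_pow_sub_one]
        have : Nat.gcd h m = 1 := by
          rw [hmh, Nat.gcd_comm]
          have : Nat.gcd (2 * h + 2) h = Nat.gcd 2 h := by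
            rw [Nat.gcd_comm]; simp [Nat.gcd_comm]
          rw [this]
          exact (Nat.coprime_two_left).2 (Nat.odd_iff.2 hh)
        rw [this, pow_one]
      rwa [h4] at h3
    have key : ∀ r : ℕ, ∑ i ∈ S', algebraMap F E (c i) * y i ^ r = 0 := by
      intro r
      obtain ⟨A, hA, hAT⟩ := exists_shift q h j r hq hqe (by omega) hj
      have hz := fiber_sum_zero S (fun i => algebraMap F E (c i) * (β ^ (i : ℕ)) ^ (A + b)) f
        (q ^ h) hcard (by
          intro k hk
          have := hsum _ (hmh ▸ hAT k hk)
          rw [← this]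
          apply Finset.sum_congr rfl
          intro i _
          rw [hf, mul_assoc]
          congr 1
          simp only
          rw [← pow_mul, ← pow_mul, ← pow_mul, ← pow_add]
          congr 1
          ring) j0 hj0S
      have hm2 : (∑ i ∈ S', algebraMap F E (c i) * y i ^ r) * ((β ^ (j0 : ℕ)) ^ (A + b)) = 0 := by
        rw [← hz, Finset.sum_mul]
        apply Finset.sum_congr
        · ext i; simp [hS']
        intro i hi
        have hi2 : f i = f j0 := (Finset.mem_filter.1 hi).2
        have h1 : y i ^ r = y i ^ A := by
          rw [pow_eq_pow_mod r (hyq i hi), pow_eq_pow_mod A (hyq i hi), hA]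
        have h2 : β ^ (i : ℕ) = y i * β ^ (j0 : ℕ) := by
          rw [hy]; exact (div_mul_cancel₀ _ (hx0 j0)).symm
        have h3 : (β ^ (i : ℕ)) ^ b = (β ^ (j0 : ℕ)) ^ b := hi2
        rw [h1, pow_add, pow_add, h3, h2, mul_pow]
        ring
      exact (mul_eq_zero.1 hm2).resolve_right (pow_ne_zero _ (hx0 j0))
    have hfin := fiber_sum_zero S' (fun i => algebraMap F E (c i)) y _ le_rfl
      (fun k _ => key k) j0 (Finset.mem_filter.2 ⟨hj0S, rfl⟩)
    have hsing : (S'.filter (fun i => y i = y j0)) = {j0} := by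
      ext i
      simp only [Finset.mem_filter, Finset.mem_singleton]
      constructor
      · rintro ⟨-, he⟩
        have he' : β ^ (i : ℕ) = β ^ (j0 : ℕ) := (div_left_inj' (hx0 j0)).1 he
        exact Fin.ext (pow_injOn_Iio_orderOf (by simp [hβ]) (by simp [hβ]) he')
      · rintro rfl
        exact ⟨Finset.mem_filter.2 ⟨hj0S, rfl⟩, rfl⟩
    have hfin2 : ∑ i ∈ S'.filter (fun i => y i = y j0), algebraMap F E (c i) = 0 := by
      convert hfin
    rw [hsing, Finset.sum_singleton] at hfin2
    exact hj0 ((map_eq_zero _).1 hfin2)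

theorem stmt13 (s q m n : ℕ) (hs : 2 ≤ s) (hq : q = 2 ^ s)
    (hm : 4 ≤ m) (hmod4 : m % 4 = 0) (hn : n = q ^ m - 1)
    (F E : Type*) [Field F] [Fintype F] [DecidableEq F] [Field E] [Fintype E] [Algebra F E]
    (hF : Fintype.card F = q) (hE : Fintype.card E = q ^ m)
    (β : E) (hβ : orderOf β = n) :
    q ^ ((m - 2) / 2) + 1 ≤ minDist (cyclicCode F E n β (Tset q m 0)) ∧
      q ^ ((m - 2) / 2) + 1 ≤ minDist (cyclicCode F E n β (Tset q m 1)) := by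
  have hq4 : 4 ≤ q := by
    rw [hq]
    exact Nat.pow_le_pow_right (n := 2) (by norm_num) hs
  have hqe : q % 2 = 0 := by
    rw [hq]
    exact Nat.mod_eq_zero_of_dvd (dvd_pow_self 2 (by omega))
  exact ⟨bound_aux q _ m n 0 hq4 hqe (by omega) (by omega) (by omega) hn F E β hβ,
    bound_aux q _ m n 1 hq4 hqe (by omega) (by omega) (by omega) hn F E β hβ⟩
end

section
/- Let s ≥ 1 be an integer, q = 2^s, m ≥ 2 an even integer, and n = q^m − 1. Then the code C_{(q,m;0)} is a linear complementary dual (LCD) code, i.e. C_{(q,m;0)} ∩ C_{(q,m;0)}^⊥ = {0}, and its dimension as an F-vector space is (n+3)/2. -/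
open Finset

/-- The dual of a set of words: all words orthogonal (for the standard bilinear form)
to every word of the set. -/
def dualSet {F : Type*} [Field F] {N : ℕ} (C : Set (Fin N → F)) : Set (Fin N → F) :=
  {u | ∀ v ∈ C, ∑ k : Fin N, u k * v k = 0}


lemma qw_cons (q a y : ℕ) (hq : 2 ≤ q) (ha : a < q) :
    qWeight q (a + q * y) = a + qWeight q y := by
  unfold qWeight
  by_cases h : a ≠ 0 ∨ y ≠ 0
  · rw [Nat.digits_add q (by omega) a y ha h]; simp
  · push Not at h
    obtain ⟨rfl, rfl⟩ := h
    simp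

lemma qw_top (q : ℕ) (hq : 2 ≤ q) (M : ℕ) : ∀ a b : ℕ, a < q → b < q ^ M →
    qWeight q (a * q ^ M + b) = a + qWeight q b := by
  induction M with
  | zero =>
    intro a b ha hb
    have hb0 : b = 0 := by simpa using hb
    subst hb0
    have := qw_cons q a 0 hq ha
    simpa using this
  | succ M ih =>
    intro a b ha hb
    have hq0 : 0 < q := by omega
    have hdiv : b / q < q ^ M := by
      rw [Nat.div_lt_iff_lt_mul hq0, ← pow_succ]; exact hb
    have hmod : b % q < q := Nat.mod_lt _ hq0
    have e1 : a * q ^ (M + 1) + b = b % q + q * (a * q ^ M + b / q) := by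
      have := Nat.mod_add_div b q
      calc a * q ^ (M + 1) + b = a * q ^ (M + 1) + (b % q + q * (b / q)) := by rw [this]
        _ = _ := by ring
    have e2 : qWeight q b = b % q + qWeight q (b / q) := by
      conv_lhs => rw [← Nat.mod_add_div b q]
      exact qw_cons q _ _ hq hmod
    rw [e1, qw_cons q _ _ hq hmod, ih a (b / q) ha hdiv, e2]
    ring

lemma qw_neg (q : ℕ) (hq : 2 ≤ q) (M : ℕ) : ∀ x y : ℕ, x + y + 1 = q ^ M →
    qWeight q x + qWeight q y = M * (q - 1) := by
  induction M with
  | zero =>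
    intro x y h
    have hx : x = 0 := by simp at h; omega
    have hy : y = 0 := by simp at h; omega
    subst hx hy
    simp [qWeight]
  | succ M ih =>
    intro x y h
    have hq0 : 0 < q := by omega
    have hx := Nat.mod_add_div x q
    have hy := Nat.mod_add_div y q
    have hxm : x % q < q := Nat.mod_lt _ hq0
    have hym : y % q < q := Nat.mod_lt _ hq0
    generalize x % q = a at *
    generalize y % q = b at *
    generalize x / q = X at *
    generalize y / q = Y at *
    subst hx hy
    have hdvd : q ∣ a + b + 1 := by
      have h1 : q ∣ (a + b + 1) + q * (X + Y) := by
        have : (a + b + 1) + q * (X + Y) = q ^ (M + 1) := by rw [← h]; ring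
        rw [this]; exact dvd_pow_self q (by omega)
      exact (Nat.dvd_add_left (dvd_mul_right q _)).1 h1
    have hab : a + b + 1 = q := by
      obtain ⟨t, ht⟩ := hdvd
      have : t = 1 := by
        have h1 : t < 2 := by nlinarith
        have h2 : t ≠ 0 := by rintro rfl; omega
        omega
      rw [ht, this, mul_one]
    have hXY : X + Y + 1 = q ^ M := by
      have : q * (X + Y + 1) = q * q ^ M := by
        rw [← pow_succ', ← h]
        nlinarith
      exact Nat.eq_of_mul_eq_mul_left hq0 this
    rw [qw_cons q a X hq hxm, qw_cons q b Y hq hym]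
    have := ih X Y hXY
    have e : a + b = q - 1 := by omega
    calc a + qWeight q X + (b + qWeight q Y) = (a + b) + (qWeight q X + qWeight q Y) := by ring
      _ = (M + 1) * (q - 1) := by rw [e, this]; ring

lemma qw_pair (q y : ℕ) (hq : 2 ≤ q) (he : Even q) :
    qWeight q (2 * y + 1) = qWeight q (2 * y) + 1 := by
  obtain ⟨r, hr⟩ := he
  have hq0 : 0 < q := by omega
  have hx := Nat.mod_add_div (2 * y) q
  have hxm : (2 * y) % q < q := Nat.mod_lt _ hq0
  generalize (2 * y) % q = a at *
  generalize (2 * y) / q = X at *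
  have ha : a + 1 < q := by
    have h2 : q * X = 2 * (r * X) := by rw [hr]; ring
    omega
  rw [← hx, show a + q * X + 1 = (a + 1) + q * X by ring, qw_cons q _ _ hq ha,
    qw_cons q _ _ hq hxm]
  ring

lemma qw_count (q : ℕ) (hq : 2 ≤ q) (he : Even q) (N : ℕ) :
    ((range (2 * N)).filter (fun i => qWeight q i % 2 = 0)).card = N := by
  induction N with
  | zero => simp
  | succ N ih =>
    rw [show 2 * (N + 1) = 2 * N + 1 + 1 by ring, range_add_one, range_add_one,
      filter_insert, filter_insert, qw_pair q N hq he]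
    by_cases h : qWeight q (2 * N) % 2 = 0
    · rw [if_neg (by omega), if_pos h, card_insert_of_notMem (by simp), ih]
    · rw [if_pos (by omega), if_neg h, card_insert_of_notMem (by simp), ih]

lemma T_neg (q m : ℕ) (hq : 2 ≤ q) (hm : Even m) (k t : ℕ) (ht : t ∈ Tset q m 0)
    (h : k + t + 1 = q ^ m) : k ∈ Tset q m 0 := by
  obtain ⟨h1, h2, h3⟩ := ht
  have := qw_neg q hq m k t h
  have he : Even (m * (q - 1)) := hm.mul_right _
  rw [← this] at he
  have h4 := Nat.even_iff.1 he
  exact ⟨by omega, by omega, by omega⟩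

lemma T_closed (q m n : ℕ) (hq : 2 ≤ q) (hm2 : 2 ≤ m) (hm : Even m) (hn : n + 1 = q ^ m)
    (t : ℕ) (ht : t ∈ Tset q m 0) (e : ℕ) : ∀ k : ℕ, k < n → n ∣ k * q ^ e + t →
    k ∈ Tset q m 0 := by
  induction e with
  | zero =>
    intro k hk hd
    apply T_neg q m hq hm k t ht
    obtain ⟨c, hc⟩ := hd
    obtain ⟨h1, h2, h3⟩ := ht
    rw [pow_zero, mul_one] at hc
    have : c = 1 := by
      have h1 : c < 2 := by
        by_contra hcc
        have : n * 2 ≤ n * c := Nat.mul_le_mul_left _ (by omega)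
        omega
      have h2 : c ≠ 0 := by rintro rfl; omega
      omega
    subst this
    omega
  | succ e ih =>
    intro k hk hd
    obtain ⟨M, rfl⟩ : ∃ M, m = M + 1 := ⟨m - 1, by omega⟩
    have hqM : 0 < q ^ M := by positivity
    have hx := Nat.mod_add_div k (q ^ M)
    have hb : k % q ^ M < q ^ M := Nat.mod_lt _ hqM
    have ha : k / q ^ M < q := by
      rw [Nat.div_lt_iff_lt_mul hqM, ← pow_succ']; omega
    generalize k % q ^ M = b at *
    generalize k / q ^ M = a at *
    have hk1 : q * k + a = (q * b + a) + a * q ^ (M + 1) := by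
      rw [← hx]; ring
    have hk2 : q * k = (q * b + a) + a * n := by
      rw [← hn] at hk1; nlinarith
    have hn' : n + 1 = q * q ^ M := by rw [hn, pow_succ']
    have hlt : q * b + a < n := by
      have h1 : q * (b + 1) ≤ q * q ^ M := Nat.mul_le_mul_left _ hb
      by_contra hcon
      have h3 : a + 1 = q := by nlinarith
      have h4 : q * (b + 1) = q * q ^ M := by nlinarith
      have h5 := Nat.eq_of_mul_eq_mul_left (by omega) h4
      have : k + 1 = n + 1 := by
        rw [← hx, hn', ← h5]; nlinarith [congrArg (fun z => z * (b + 1)) h3]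
      omega
    have hmem := ih (q * b + a) hlt (by
      have : k * q ^ (e + 1) + t = ((q * b + a) * q ^ e + t) + n * (a * q ^ e) := by
        calc k * q ^ (e + 1) + t = (q * k) * q ^ e + t := by ring
          _ = _ := by rw [hk2]; ring
      rw [this] at hd
      exact (Nat.dvd_add_left (dvd_mul_right n _)).1 hd)
    obtain ⟨h1, h2, h3⟩ := hmem
    have w1 : qWeight q (q * b + a) = a + qWeight q b := by
      rw [add_comm]; exact qw_cons q a b hq ha
    have w2 : qWeight q k = a + qWeight q b := by
      rw [← hx, add_comm, mul_comm]; exact qw_top q hq M a b ha hb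
    refine ⟨?_, by omega, by rw [w2, ← w1]; exact h3⟩
    rcases Nat.eq_zero_or_pos k with h0 | h0
    · exfalso
      rw [h0] at hk2
      omega
    · exact h0

section codes

variable {F E : Type*} [Field F] [Field E] [Algebra F E]

lemma word_zero (n : ℕ) (β : E) (hβ : orderOf β = n) (S : Finset ℕ) (hS : S ⊆ range n)
    (c : Fin n → F) (hc : ∀ k ∈ S, ∑ j : Fin n, algebraMap F E (c j) * β ^ (k * (j : ℕ)) = 0)
    (h0 : ∀ j : Fin n, S.card ≤ j → c j = 0) : c = 0 := by
  classical
  let p : Polynomial E := ∑ j : Fin n, Polynomial.monomial (j : ℕ) (algebraMap F E (c j))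
  have hp : p = 0 := by
    apply Polynomial.eq_zero_of_degree_lt_of_eval_index_eq_zero (s := S) (v := fun k => β ^ k)
    · intro a ha b hb hab
      apply pow_injOn_Iio_orderOf _ _ hab
      · have := hS ha; rw [hβ]; simpa using this
      · have := hS hb; rw [hβ]; simpa using this
    · rw [Polynomial.degree_lt_iff_coeff_zero]
      intro i hi
      simp only [p, Polynomial.finsetSum_coeff, Polynomial.coeff_monomial]
      apply sum_eq_zero
      intro j _
      split_ifs with hj
      · rw [h0 j (by omega), map_zero]
      · rfl
    · intro k hk
      simp only [p, Polynomial.eval_finsetSum, Polynomial.eval_monomial, ← pow_mul]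
      exact hc k hk
  funext j
  have h := congrArg (fun r => Polynomial.coeff r (j : ℕ)) hp
  simp only [p, Polynomial.finsetSum_coeff, Polynomial.coeff_monomial, Fin.val_inj,
    Polynomial.coeff_zero, sum_ite_eq', mem_univ, if_true] at h
  simpa using h

lemma dim_le (n : ℕ) (β : E) (hβ : orderOf β = n) (S : Finset ℕ) (hS : S ⊆ range n)
    (W : Submodule F (Fin n → F))
    (hW : ∀ c ∈ W, ∀ k ∈ S, ∑ j : Fin n, algebraMap F E (c j) * β ^ (k * (j : ℕ)) = 0) :
    Module.finrank F W + S.card ≤ n := by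
  have hcard : S.card ≤ n := by simpa using card_le_card hS
  let f : (Fin n → F) →ₗ[F] (Fin (n - S.card) → F) :=
    LinearMap.funLeft F F (fun i => ⟨i + S.card, by omega⟩)
  have hinj : Function.Injective (f ∘ₗ W.subtype) := by
    rw [← LinearMap.ker_eq_bot, LinearMap.ker_eq_bot']
    intro c hc
    apply Subtype.ext
    apply word_zero n β hβ S hS c.1 (hW c.1 c.2)
    intro j hj
    have := congrFun hc ⟨j - S.card, by omega⟩
    simp only [f, LinearMap.comp_apply, LinearMap.funLeft_apply, Submodule.subtype_apply,
      Pi.zero_apply] at this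
    convert this using 2
    apply Fin.ext
    simp
    omega
  have := LinearMap.finrank_le_finrank_of_injective hinj
  rw [Module.finrank_fin_fun] at this
  omega

lemma geom_zero (n : ℕ) (β γ : E) (hβ : orderOf β = n) (e : ℕ) (hγ : γ = β ^ e)
    (h : ¬ n ∣ e) : ∑ j : Fin n, γ ^ (j : ℕ) = 0 := by
  rw [Fin.sum_univ_eq_sum_range (fun j => γ ^ j) n]
  have h1 : γ ≠ 1 := by
    rw [hγ]; intro h1; apply h; rw [← hβ]; exact orderOf_dvd_of_pow_eq_one h1
  have h2 : γ ^ n = 1 := by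
    rw [hγ, ← pow_mul, mul_comm, pow_mul, ← hβ, pow_orderOf_eq_one, one_pow]
  have := mul_geom_sum γ n
  rw [h2, sub_self] at this
  exact (mul_eq_zero.1 this).resolve_left (sub_ne_zero.2 h1)

lemma dual_zero [Fintype F] [Fintype E] (q m n : ℕ) (hq : 2 ≤ q) (hm2 : 2 ≤ m) (hm : Even m)
    (hn : n + 1 = q ^ m) (hF : Fintype.card F = q) (β : E) (hβ : orderOf β = n)
    (u : Fin n → F)
    (hu : ∀ v ∈ cyclicCode F E n β (Tset q m 0), ∑ k : Fin n, u k * v k = 0)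
    (k : ℕ) (hk : k < n) (hkT : k ∉ Tset q m 0) :
    ∑ j : Fin n, algebraMap F E (u j) * β ^ (k * (j : ℕ)) = 0 := by
  have key : ∀ a : E, Algebra.trace F E
      (a * ∑ j : Fin n, algebraMap F E (u j) * β ^ (k * (j : ℕ))) = 0 := by
    intro a
    have := hu (fun j => Algebra.trace F E (a * β ^ (k * (j : ℕ)))) (by
      intro t ht
      simp only [FiniteField.algebraMap_trace_eq_sum_pow, Finset.sum_mul]
      rw [sum_comm]
      apply sum_eq_zero
      intro e _
      rw [Nat.card_eq_fintype_card, hF]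
      have hg := geom_zero n β (β ^ (k * q ^ e + t)) hβ (k * q ^ e + t) rfl
        (fun hd => hkT (T_closed q m n hq hm2 hm hn t ht e k hk hd))
      calc ∑ j : Fin n, (a * β ^ (k * (j : ℕ))) ^ q ^ e * β ^ (t * (j : ℕ))
          = ∑ j : Fin n, a ^ q ^ e * (β ^ (k * q ^ e + t)) ^ (j : ℕ) := by
            apply sum_congr rfl
            intro j _
            ring
        _ = 0 := by rw [← mul_sum, hg, mul_zero])
    rw [← this, mul_sum, map_sum]
    apply sum_congr rfl
    intro j _
    rw [show a * (algebraMap F E (u j) * β ^ (k * (j : ℕ))) = u j • (a * β ^ (k * (j : ℕ))) by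
      rw [Algebra.smul_def]; ring]
    rw [map_smul, smul_eq_mul]
  have hnd := traceForm_nondegenerate F E
  apply hnd.2
  intro a
  rw [Algebra.traceForm_apply]
  exact key a

end codes

theorem stmt18 (s q m n : ℕ) (hs : 1 ≤ s) (hq : q = 2 ^ s)
    (hm : 2 ≤ m) (hmeven : Even m) (hn : n = q ^ m - 1)
    (F E : Type*) [Field F] [Fintype F] [DecidableEq F] [Field E] [Fintype E] [Algebra F E]
    (hF : Fintype.card F = q) (hE : Fintype.card E = q ^ m)
    (β : E) (hβ : orderOf β = n) :
    (cyclicCode F E n β (Tset q m 0) : Set (Fin n → F)) ∩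
        dualSet (cyclicCode F E n β (Tset q m 0) : Set (Fin n → F)) = {0} ∧
      Module.finrank F (cyclicCode F E n β (Tset q m 0)) = (n + 3) / 2 := by
  classical
  have hq2 : 2 ≤ q := by
    rw [hq]; calc 2 = 2 ^ 1 := by norm_num
      _ ≤ 2 ^ s := Nat.pow_le_pow_right (by norm_num) hs
  have hqe : Even q := by rw [hq]; exact (Nat.even_pow.2 ⟨even_two, by omega⟩)
  have hqm : 4 ≤ q ^ m := by
    calc 4 = 2 ^ 2 := by norm_num
      _ ≤ q ^ 2 := Nat.pow_le_pow_left hq2 2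
      _ ≤ q ^ m := Nat.pow_le_pow_right (by omega) hm
  have hn1 : n + 1 = q ^ m := by omega
  have hD := dual_zero (F := F) (E := E) q m n hq2 hm hmeven hn1 hF β hβ
  constructor
  · apply Set.eq_singleton_iff_unique_mem.2
    refine ⟨⟨Submodule.zero_mem _, fun v _ => by simp⟩, ?_⟩
    rintro u ⟨hu1, hu2⟩
    apply word_zero n β hβ (range n) (Subset.refl _) u
    · intro k hk
      by_cases hkT : k ∈ Tset q m 0
      · exact hu1 k hkT
      · exact hD u hu2 k (mem_range.1 hk) hkT
    · intro j hj
      have := j.2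
      simp at hj
      omega
  · obtain ⟨N, hN⟩ : Even (q ^ m) := hqe.pow_of_ne_zero (by omega)
    let S : Finset ℕ := (range n).filter (fun k => k ∈ Tset q m 0)
    let S' : Finset ℕ := (range n).filter (fun k => ¬ k ∈ Tset q m 0)
    have hSS : S.card + S'.card = n := by
      have := card_filter_add_card_filter_not (s := range n) (fun k => k ∈ Tset q m 0)
      simpa using this
    have hcount := qw_count q hq2 hqe N
    have hSeq : (range (2 * N)).filter (fun i => qWeight q i % 2 = 0) = insert 0 (insert n S) := by
      ext i
      have h0 : qWeight q 0 % 2 = 0 := by simp [qWeight]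
      have h1 : qWeight q n % 2 = 0 := by
        have := qw_neg q hq2 m 0 n (by omega)
        have he : Even (m * (q - 1)) := hmeven.mul_right _
        rw [← this] at he
        have := Nat.even_iff.1 he
        omega
      simp only [S, mem_filter, mem_range, mem_insert, Tset, Set.mem_setOf_eq]
      constructor
      · rintro ⟨h2, h3⟩
        by_cases hi0 : i = 0
        · left; exact hi0
        by_cases hin : i = n
        · right; left; exact hin
        right; right
        exact ⟨by omega, by omega, by omega, h3⟩
      · rintro (rfl | rfl | ⟨h2, h3, h4, h5⟩)
        · exact ⟨by omega, h0⟩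
        · exact ⟨by omega, h1⟩
        · exact ⟨by omega, h5⟩
    have hScard : S.card + 2 = N := by
      rw [hSeq, card_insert_of_notMem, card_insert_of_notMem] at hcount
      · exact hcount
      · simp [S]
      · intro h
        rcases mem_insert.1 h with h | h
        · omega
        · have h1 := (mem_filter.1 h).2.1
          omega
    have hle := dim_le n β hβ S (filter_subset _ _) (cyclicCode F E n β (Tset q m 0))
      (fun c hc k hk => hc k (mem_filter.1 hk).2)
    let A := (cyclicCode F E n β (Tset q m 0)).dualAnnihilator
    let W := A.map (dotProductEquiv F (Fin n)).symm.toLinearMap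
    have hle' := dim_le n β hβ S' (filter_subset _ _) W (by
      rintro c ⟨φ, hφ, rfl⟩ k hk
      have hk' := mem_filter.1 hk
      refine hD _ ?_ k (mem_range.1 hk'.1) hk'.2
      intro v hv
      have h1 := (Submodule.mem_dualAnnihilator φ).1 hφ v hv
      have h2 : dotProductEquiv F (Fin n) ((dotProductEquiv F (Fin n)).symm φ) v = 0 := by
        rw [LinearEquiv.apply_symm_apply]; exact h1
      rw [dotProductEquiv_apply_apply] at h2
      exact h2)
    have hWA : Module.finrank F W = Module.finrank F A :=
      LinearEquiv.finrank_map_eq (dotProductEquiv F (Fin n)).symm A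
    have hsum := Subspace.finrank_add_finrank_dualAnnihilator_eq
      (cyclicCode F E n β (Tset q m 0))
    rw [Module.finrank_fin_fun] at hsum
    change _ + Module.finrank F A = n at hsum
    omega
end
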